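/- Let F be a deformation functor of Artin rings over a field K of characteristic zero. Then F(A) is a one-point set for every A in Art if and only if the tangent space t_F = F(K[ε]) is a one-point set (equivalently, the zero vector space). -/

import Mathlib

/-- A local Artinian `K`-algebra with residue field `K` (an object of the category `Art_K`). -/
structure ArtinAlgebra (K : Type) [Field K] : Type 1 where
  carrier : Type
  [commRing : CommRing carrier]
  [alg : Algebra K carrier]
  [artinian : IsArtinianRing carrier]
  [isLocal : IsLocalRing carrier]
  residue_bij : Function.Bijective (algebraMap K (IsLocalRing.ResidueField carrier))

attribute [instance] ArtinAlgebra.commRing ArtinAlgebra.alg ArtinAlgebra.artinian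
  ArtinAlgebra.isLocal

variable {K : Type} [Field K]

namespace ArtinAlgebra

/-- The maximal ideal of a local Artinian algebra. -/
abbrev m (A : ArtinAlgebra K) : Ideal A.carrier := IsLocalRing.maximalIdeal A.carrier

/-- `P`, with projections `pB`, `pC`, is the fiber product `B ×_A C` of `β : B → A` and
`γ : C → A` in the category of local Artinian `K`-algebras. -/
structure IsFiberProduct {A B C P : ArtinAlgebra K}
    (β : B.carrier →ₐ[K] A.carrier) (γ : C.carrier →ₐ[K] A.carrier)
    (pB : P.carrier →ₐ[K] B.carrier) (pC : P.carrier →ₐ[K] C.carrier) : Prop where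
  comm : ∀ p, β (pB p) = γ (pC p)
  inj : ∀ p q, pB p = pB q → pC p = pC q → p = q
  surj : ∀ b c, β b = γ c → ∃ p, pB p = b ∧ pC p = c

/-- `A` is (isomorphic to) the base field `K` itself. -/
def IsBase (A : ArtinAlgebra K) : Prop := Function.Bijective (algebraMap K A.carrier)

end ArtinAlgebra

/-- A functor of Artin rings: a covariant functor `Art_K → Set` with `F(K)` a point. -/
structure ArtinFunctor (K : Type) [Field K] : Type 1 where
  obj : ArtinAlgebra K → Type
  map : ∀ {A B : ArtinAlgebra K}, (A.carrier →ₐ[K] B.carrier) → obj A → obj B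
  map_id : ∀ (A : ArtinAlgebra K) (x : obj A), map (AlgHom.id K A.carrier) x = x
  map_comp : ∀ {A B C : ArtinAlgebra K} (f : A.carrier →ₐ[K] B.carrier)
      (g : B.carrier →ₐ[K] C.carrier) (x : obj A), map (g.comp f) x = map g (map f x)
  obj_point : ∀ A : ArtinAlgebra K, A.IsBase → Nonempty (obj A) ∧ Subsingleton (obj A)

namespace ArtinFunctor

variable (F : ArtinFunctor K)

/-- Surjectivity of the natural map `η : F(B ×_A C) → F(B) ×_{F(A)} F(C)`. -/
def EtaSurjective {A B C P : ArtinAlgebra K}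
    (β : B.carrier →ₐ[K] A.carrier) (γ : C.carrier →ₐ[K] A.carrier)
    (pB : P.carrier →ₐ[K] B.carrier) (pC : P.carrier →ₐ[K] C.carrier) : Prop :=
  ∀ (xB : F.obj B) (xC : F.obj C), F.map β xB = F.map γ xC →
    ∃ ξ : F.obj P, F.map pB ξ = xB ∧ F.map pC ξ = xC

/-- Injectivity of the natural map `η : F(B ×_A C) → F(B) ×_{F(A)} F(C)`. -/
def EtaInjective {A B C P : ArtinAlgebra K}
    (β : B.carrier →ₐ[K] A.carrier) (γ : C.carrier →ₐ[K] A.carrier)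
    (pB : P.carrier →ₐ[K] B.carrier) (pC : P.carrier →ₐ[K] C.carrier) : Prop :=
  ∀ ξ ξ' : F.obj P, F.map pB ξ = F.map pB ξ' → F.map pC ξ = F.map pC ξ' → ξ = ξ'

/-- `F` is a deformation functor: `η` is surjective whenever `B → A` is surjective, and
bijective whenever moreover `A = K`. -/
def IsDeformationFunctor : Prop :=
  ∀ ⦃A B C P : ArtinAlgebra K⦄
    (β : B.carrier →ₐ[K] A.carrier) (γ : C.carrier →ₐ[K] A.carrier)
    (pB : P.carrier →ₐ[K] B.carrier) (pC : P.carrier →ₐ[K] C.carrier),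
    ArtinAlgebra.IsFiberProduct β γ pB pC → Function.Surjective β →
      F.EtaSurjective β γ pB pC ∧ (A.IsBase → F.EtaInjective β γ pB pC)

/-- `F` is homogeneous: `η` is bijective whenever `B → A` is surjective. -/
def IsHomogeneous : Prop :=
  ∀ ⦃A B C P : ArtinAlgebra K⦄
    (β : B.carrier →ₐ[K] A.carrier) (γ : C.carrier →ₐ[K] A.carrier)
    (pB : P.carrier →ₐ[K] B.carrier) (pC : P.carrier →ₐ[K] C.carrier),
    ArtinAlgebra.IsFiberProduct β γ pB pC → Function.Surjective β →
      F.EtaSurjective β γ pB pC ∧ F.EtaInjective β γ pB pC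

end ArtinFunctor

/-- A natural transformation (morphism) of functors of Artin rings. -/
structure ArtinNatTrans (F G : ArtinFunctor K) where
  app : ∀ A : ArtinAlgebra K, F.obj A → G.obj A
  naturality : ∀ {A B : ArtinAlgebra K} (f : A.carrier →ₐ[K] B.carrier) (x : F.obj A),
    app B (F.map f x) = G.map f (app A x)

namespace ArtinNatTrans

variable {F G : ArtinFunctor K}

/-- `φ : F → G` is smooth: `F(B) → G(B) ×_{G(A)} F(A)` is surjective for every
surjection `B → A` in `Art_K`. -/
def IsSmooth (φ : ArtinNatTrans F G) : Prop :=
  ∀ ⦃A B : ArtinAlgebra K⦄ (f : B.carrier →ₐ[K] A.carrier), Function.Surjective f →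
    ∀ (x : F.obj A) (y : G.obj B), G.map f y = φ.app A x →
      ∃ z : F.obj B, F.map f z = x ∧ φ.app B z = y

/-- `φ : F → G` is unramified: the induced map on tangent spaces
`t_F = F(K[ε]) → t_G = G(K[ε])` is injective. -/
def IsUnramified (φ : ArtinNatTrans F G) : Prop :=
  ∀ E : ArtinAlgebra K, Nonempty (E.carrier ≃ₐ[K] DualNumber K) →
    Function.Injective (φ.app E)

/-- `φ : F → G` is étale: smooth and unramified. -/
def IsEtale (φ : ArtinNatTrans F G) : Prop := φ.IsSmooth ∧ φ.IsUnramified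

end ArtinNatTrans

namespace ArtinAlgebra

open IsLocalRing

/-- A finite-dimensional `K`-algebra with an augmentation to `K` whose kernel is nil, as a local
Artinian `K`-algebra. -/
abbrev ofAugmentation (R : Type) [CommRing R] [Algebra K R] [Module.Finite K R]
    (ρ : R →ₐ[K] K) (hρ : ∀ x, ρ x = 0 → IsNilpotent x) : ArtinAlgebra K :=
  have unit_of_ne {x : R} (hx : ρ x ≠ 0) : IsUnit x := by
    have hn : IsNilpotent (x - algebraMap K R (ρ x)) := hρ _ (by simp)
    have hu : IsUnit (algebraMap K R (ρ x)) := (isUnit_iff_ne_zero.mpr hx).map _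
    simpa using hn.isUnit_add_right_of_commute hu (Commute.all _ _)
  haveI : IsLocalHom (ρ : R →+* K) := ⟨fun _ hx => unit_of_ne hx.ne_zero⟩
  haveI : IsLocalRing R := (ρ : R →+* K).domain_isLocalRing
  { carrier := R
    artinian := IsArtinianRing.of_finite K R
    residue_bij := by
      refine ⟨(algebraMap K _).injective, fun y => ?_⟩
      obtain ⟨x, rfl⟩ := residue_surjective y
      refine ⟨ρ x, ?_⟩
      rw [IsScalarTower.algebraMap_apply K R (ResidueField R), ResidueField.algebraMap_eq,
        ← sub_eq_zero, ← map_sub, residue_eq_zero_iff, mem_maximalIdeal, mem_nonunits_iff]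
      intro hu
      have := (hu.map ρ).ne_zero
      simp at this }

variable (A : ArtinAlgebra K)

/-- The augmentation `A → K` of a local Artinian `K`-algebra with residue field `K`. -/
noncomputable def augmentation : A.carrier →ₐ[K] K :=
  ((AlgEquiv.ofBijective (Algebra.ofId K (ResidueField A.carrier)) A.residue_bij).symm :
    ResidueField A.carrier →ₐ[K] K).comp
      (IsScalarTower.toAlgHom K A.carrier (ResidueField A.carrier))

variable {A}

theorem augmentation_eq_zero_iff {x : A.carrier} : A.augmentation x = 0 ↔ x ∈ A.m := by
  simp [augmentation, ResidueField.algebraMap_eq]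

theorem isNilpotent_of_mem {x : A.carrier} (hx : x ∈ A.m) : IsNilpotent x := by
  obtain ⟨n, hn⟩ := IsArtinianRing.isNilpotent_jacobson_bot (R := A.carrier)
  rw [jacobson_eq_maximalIdeal ⊥ bot_ne_top] at hn
  exact ⟨n, by simpa [hn] using Ideal.pow_mem_pow hx n⟩

theorem sub_augmentation_mem (x : A.carrier) :
    x - algebraMap K A.carrier (A.augmentation x) ∈ A.m := by
  rw [← augmentation_eq_zero_iff]
  simp

variable (A) in
theorem finite : Module.Finite K A.carrier := by
  refine Module.finite_of_surjective_of_ker_le_nilradical A.augmentation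
    (fun k => ⟨algebraMap K _ k, by simp⟩) (fun x hx => ?_) (IsNoetherian.noetherian _)
  exact isNilpotent_of_mem (augmentation_eq_zero_iff.mp hx)

theorem isBase_of_m_eq_bot (h : A.m = ⊥) : A.IsBase := by
  refine ⟨(algebraMap K _).injective, fun x => ⟨A.augmentation x, ?_⟩⟩
  have := sub_augmentation_mem x
  rw [h, Ideal.mem_bot, sub_eq_zero] at this
  exact this.symm

/-- The maximal ideal of a local Artinian algebra other than the base field meets the socle. -/
theorem exists_socle_element (h : A.m ≠ ⊥) :
    ∃ s ∈ A.m, s ≠ 0 ∧ ∀ x ∈ A.m, x * s = 0 := by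
  classical
  have hex : ∃ n, A.m ^ n = ⊥ := by
    have := IsArtinianRing.isNilpotent_jacobson_bot (R := A.carrier)
    rwa [jacobson_eq_maximalIdeal ⊥ bot_ne_top] at this
  obtain ⟨n, hn⟩ : ∃ n, Nat.find hex = n + 1 := by
    refine Nat.exists_eq_succ_of_ne_zero fun h0 => ?_
    have := Nat.find_spec hex
    rw [h0, pow_zero, Ideal.one_eq_top] at this
    exact bot_ne_top this.symm
  have hmin : A.m ^ n ≠ ⊥ := Nat.find_min hex (by omega)
  have hbot : A.m ^ (n + 1) = ⊥ := hn ▸ Nat.find_spec hex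
  obtain ⟨s, hs, hs0⟩ := Submodule.exists_mem_ne_zero_of_ne_bot hmin
  have hann : ∀ x ∈ A.m, x * s = 0 := fun x hx => by
    have := Ideal.mul_mem_mul hx hs
    rwa [← pow_succ', hbot, Ideal.mem_bot] at this
  refine ⟨s, ?_, hs0, hann⟩
  by_contra hsm
  have hu : IsUnit s := by simpa using hsm
  exact h (eq_bot_iff.mpr fun x hx => hu.mul_left_eq_zero.mp (hann x hx))

theorem mul_socle_element {s : A.carrier} (hs : ∀ x ∈ A.m, x * s = 0) (x : A.carrier) :
    x * s = A.augmentation x • s := by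
  have := hs _ (sub_augmentation_mem x)
  rw [sub_mul, sub_eq_zero] at this
  rw [this, Algebra.smul_def]

variable (K) in
/-- The base field. -/
noncomputable abbrev base : ArtinAlgebra K :=
  ofAugmentation K (AlgHom.id K K) fun x hx => by simp_all

variable (K) in
/-- The algebra of dual numbers `K[ε]`. -/
noncomputable abbrev dual : ArtinAlgebra K :=
  haveI : Module.Finite K (DualNumber K) := inferInstanceAs (Module.Finite K (K × K))
  ofAugmentation (DualNumber K) (TrivSqZeroExt.fstHom K K K) fun x hx =>
    TrivSqZeroExt.isNilpotent_iff_isNilpotent_fst.mpr (by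
      rw [show x.fst = 0 from hx]
      exact IsNilpotent.zero)

variable (A) in
/-- The underlying algebra of `A ×_K K[ε]`. -/
noncomputable abbrev dualProdSubalgebra : Subalgebra K (A.carrier × DualNumber K) :=
  AlgHom.equalizer (A.augmentation.comp (AlgHom.fst K _ _))
    ((TrivSqZeroExt.fstHom K K K).comp (AlgHom.snd K _ _))

variable (A) in
/-- The fiber product `A ×_K K[ε]`. -/
noncomputable abbrev dualProd : ArtinAlgebra K :=
  haveI := A.finite
  haveI : Module.Finite K (DualNumber K) := inferInstanceAs (Module.Finite K (K × K))
  haveI : Module.Finite K A.dualProdSubalgebra :=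
    inferInstanceAs (Module.Finite K (Subalgebra.toSubmodule A.dualProdSubalgebra))
  ofAugmentation A.dualProdSubalgebra
    ((A.augmentation.comp (AlgHom.fst K _ _)).comp A.dualProdSubalgebra.val) (by
      rintro ⟨⟨a, e⟩, hae⟩ ha
      replace ha : A.augmentation a = 0 := ha
      have he : IsNilpotent e := TrivSqZeroExt.isNilpotent_iff_isNilpotent_fst.mpr (by
        rw [show e.fst = 0 from (show A.augmentation a = e.fst from hae) ▸ ha]
        exact IsNilpotent.zero)
      obtain ⟨k, hk⟩ := isNilpotent_of_mem (augmentation_eq_zero_iff.mp ha)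
      obtain ⟨l, hl⟩ := he
      exact ⟨k + l, Subtype.ext (Prod.ext (by simp [pow_add, hk]) (by simp [pow_add, hl]))⟩)

variable (A) in
/-- The projection `A ×_K K[ε] → A`. -/
noncomputable def dualProdFst : A.dualProd.carrier →ₐ[K] A.carrier :=
  (AlgHom.fst K _ _).comp A.dualProdSubalgebra.val

variable (A) in
/-- The projection `A ×_K K[ε] → K[ε]`. -/
noncomputable def dualProdSnd : A.dualProd.carrier →ₐ[K] (dual K).carrier :=
  (AlgHom.snd K _ _).comp A.dualProdSubalgebra.val

variable (A) in
/-- The section `a ↦ (a, ρ a)` of the projection `A ×_K K[ε] → A`. -/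
noncomputable def dualProdSection : A.carrier →ₐ[K] A.dualProd.carrier :=
  AlgHom.codRestrict ((AlgHom.id K _).prod
    ((TrivSqZeroExt.inlAlgHom K K K).comp A.augmentation)) A.dualProdSubalgebra fun _ => rfl

/-- The map `A ×_K K[ε] → A`, `(a, k + t ε) ↦ a + t s`, for an element `s` of the socle. -/
noncomputable def dualProdAdd {s : A.carrier} (hsm : s ∈ A.m) (hs : ∀ x ∈ A.m, x * s = 0) :
    A.dualProd.carrier →ₐ[K] A.carrier :=
  AlgHom.ofLinearMap
    (A.dualProdFst.toLinearMap +
      (LinearMap.toSpanSingleton K A.carrier s).comp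
        ((TrivSqZeroExt.sndHom K K).comp A.dualProdSnd.toLinearMap))
    (by simp [dualProdSnd])
    (by
      rintro ⟨⟨a, e⟩, hae⟩ ⟨⟨b, f⟩, hbf⟩
      replace hae : A.augmentation a = e.fst := hae
      replace hbf : A.augmentation b = f.fst := hbf
      change a * b + (e * f).snd • s = (a + e.snd • s) * (b + f.snd • s)
      have ha := mul_socle_element hs a
      have hb := mul_socle_element hs b
      have hss := hs s hsm
      rw [DualNumber.snd_mul, ← hae, ← hbf]
      simp only [Algebra.smul_def, map_add, map_mul] at ha hb ⊢
      linear_combination (-algebraMap K A.carrier f.snd) * ha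
        - algebraMap K A.carrier e.snd * hb
        - algebraMap K A.carrier e.snd * algebraMap K A.carrier f.snd * hss)

/-- The quotient of `A` by an ideal contained in its maximal ideal. -/
noncomputable abbrev quotient (I : Ideal A.carrier) (hI : I ≤ A.m) : ArtinAlgebra K :=
  haveI := A.finite
  ofAugmentation (A.carrier ⧸ I)
    (Ideal.Quotient.liftₐ I A.augmentation fun _ ha => augmentation_eq_zero_iff.mpr (hI ha))
    fun x hx => by
      obtain ⟨a, rfl⟩ := Ideal.Quotient.mk_surjective x
      exact (isNilpotent_of_mem (augmentation_eq_zero_iff.mp hx)).map (Ideal.Quotient.mk I)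

theorem isFiberProduct_dualProd :
    IsFiberProduct (A := base K) (B := A) (C := dual K) (P := A.dualProd)
      A.augmentation (TrivSqZeroExt.fstHom K K K) A.dualProdFst A.dualProdSnd where
  comm p := p.2
  inj _ _ h₁ h₂ := Subtype.ext (Prod.ext h₁ h₂)
  surj a e h := ⟨⟨(a, e), h⟩, rfl, rfl⟩

theorem isFiberProduct_dualProdAdd {s : A.carrier} (hsm : s ∈ A.m) (hs0 : s ≠ 0)
    (hs : ∀ x ∈ A.m, x * s = 0) (hI : Ideal.span {s} ≤ A.m) :
    IsFiberProduct (A := quotient (Ideal.span {s}) hI) (B := A) (C := A) (P := A.dualProd)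
      (Ideal.Quotient.mkₐ K (Ideal.span {s})) (Ideal.Quotient.mkₐ K (Ideal.span {s}))
      A.dualProdFst (dualProdAdd hsm hs) where
  comm := by
    rintro ⟨⟨a, e⟩, hae⟩
    refine Ideal.Quotient.eq.mpr ?_
    change a - (a + e.snd • s) ∈ _
    rw [sub_add_cancel_left, Algebra.smul_def]
    exact neg_mem (Ideal.mul_mem_left _ _ (Ideal.mem_span_singleton_self s))
  inj := by
    rintro ⟨⟨a, e⟩, hae⟩ ⟨⟨b, f⟩, hbf⟩ h₁ h₂
    replace hae : A.augmentation a = e.fst := hae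
    replace hbf : A.augmentation b = f.fst := hbf
    replace h₁ : a = b := h₁
    subst h₁
    replace h₂ : a + e.snd • s = a + f.snd • s := h₂
    have hsnd : e.snd = f.snd := smul_left_injective K hs0 (add_left_cancel h₂)
    exact Subtype.ext (Prod.ext rfl (TrivSqZeroExt.ext (hae.symm.trans hbf) hsnd))
  surj a b h := by
    obtain ⟨c, hc⟩ := Ideal.mem_span_singleton'.mp (Ideal.Quotient.eq.mp h.symm)
    refine ⟨⟨(a, (A.augmentation a, A.augmentation c)), rfl⟩, rfl, ?_⟩
    change a + A.augmentation c • s = b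
    rw [← mul_socle_element hs, hc]
    ring

end ArtinAlgebra

namespace ArtinFunctor

open ArtinAlgebra

variable {F : ArtinFunctor K}

theorem nonempty_obj (F : ArtinFunctor K) (A : ArtinAlgebra K) : Nonempty (F.obj A) :=
  (F.obj_point (base K) Function.bijective_id).1.map (F.map (Algebra.ofId K A.carrier))

/-- If `F` has trivial tangent space, then `F(A)` is a point as soon as `F` is a point on the
quotient of `A` by a nonzero socle element. -/
theorem IsDeformationFunctor.subsingleton_of_quotient (hF : F.IsDeformationFunctor)
    (hdual : Subsingleton (F.obj (dual K))) {A : ArtinAlgebra K} {s : A.carrier}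
    (hsm : s ∈ A.m) (hs0 : s ≠ 0) (hs : ∀ x ∈ A.m, x * s = 0) (hI : Ideal.span {s} ≤ A.m)
    (hq : Subsingleton (F.obj (quotient (Ideal.span {s}) hI))) : Subsingleton (F.obj A) := by
  refine ⟨fun x y => ?_⟩
  have hfst : A.dualProdFst.comp A.dualProdSection = AlgHom.id K A.carrier := rfl
  have hadd : (dualProdAdd hsm hs).comp A.dualProdSection = AlgHom.id K A.carrier := by
    ext a
    change a + (0 : K) • s = a
    simp
  obtain ⟨z, hz₁, hz₂⟩ := (hF _ _ _ _ (isFiberProduct_dualProdAdd hsm hs0 hs hI)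
    (Ideal.Quotient.mkₐ_surjective K _)).1 x y (Subsingleton.elim _ _)
  have hz : z = F.map A.dualProdSection x := by
    refine (hF _ _ _ _ isFiberProduct_dualProd fun k => ⟨algebraMap K _ k, by simp⟩).2
      Function.bijective_id _ _ ?_ (Subsingleton.elim _ _)
    rw [hz₁, ← F.map_comp, hfst, F.map_id]
  rw [← hz₂, hz, ← F.map_comp, hadd, F.map_id]

theorem IsDeformationFunctor.subsingleton_obj (hF : F.IsDeformationFunctor)
    (hdual : Subsingleton (F.obj (dual K))) (A : ArtinAlgebra K) : Subsingleton (F.obj A) := by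
  induction hn : Module.finrank K A.carrier using Nat.strong_induction_on generalizing A with
  | _ n ih =>
    by_cases hm : A.m = ⊥
    · exact (F.obj_point A (isBase_of_m_eq_bot hm)).2
    obtain ⟨s, hsm, hs0, hs⟩ := exists_socle_element hm
    have hI : Ideal.span {s} ≤ A.m := (Ideal.span_singleton_le_iff_mem _).mpr hsm
    refine hF.subsingleton_of_quotient hdual hsm hs0 hs hI (ih _ ?_ _ rfl)
    have := A.finite
    let q : A.carrier →ₗ[K] A.carrier ⧸ Ideal.span {s} :=
      (Ideal.Quotient.mkₐ K (Ideal.span {s})).toLinearMap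
    have hq : Function.Surjective q := Ideal.Quotient.mkₐ_surjective K _
    rw [← hn]
    refine lt_of_le_of_ne (q.finrank_le_finrank_of_surjective hq) fun heq => hs0 ?_
    refine (LinearMap.injective_iff_surjective_of_finrank_eq_finrank heq.symm).mpr hq ?_
    rw [map_zero]
    exact Ideal.Quotient.eq_zero_iff_mem.mpr (Ideal.mem_span_singleton_self s)

end ArtinFunctor

/-- Let `F` be a deformation functor of Artin rings over a field `K` of
characteristic zero.  Then `F(A)` is a one-point set for every `A` in `Art_K` if and only
if the tangent space `t_F = F(K[ε])` is a one-point set. -/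
theorem trivial_iff_tangent_trivial {K : Type} [Field K] [CharZero K]
    (F : ArtinFunctor K) (hF : F.IsDeformationFunctor) :
    (∀ A : ArtinAlgebra K, Nonempty (F.obj A) ∧ Subsingleton (F.obj A)) ↔
      (∀ E : ArtinAlgebra K, Nonempty (E.carrier ≃ₐ[K] DualNumber K) →
        Nonempty (F.obj E) ∧ Subsingleton (F.obj E)) := by
  refine ⟨fun h E _ => h E, fun h A => ⟨F.nonempty_obj A, ?_⟩⟩
  exact hF.subsingleton_obj (h (ArtinAlgebra.dual K) ⟨AlgEquiv.refl⟩).2 A
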